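/- arXiv:2107.12687 — 5 statements merged into one kernel-verified Lean document; each statement's English description precedes it below -/
import Mathlib

section
/- Let n, d be positive integers, let Ω ⊂ ℝ^n be a bounded open set, and let w ∈ L¹(Ω;ℝ^d). Then there exists a sequence (v_j) in L¹(Ω;ℝ^d) such that: (i) ℒ^n({x ∈ Ω : v_j(x) ≠ 0}) → 0 as j → ∞ (in particular v_j → 0 in Lebesgue measure on Ω); (ii) for every continuous function φ : closure(Ω) → ℝ^d one has ∫_Ω ⟨φ(x), v_j(x)⟩ dx → ∫_Ω ⟨φ(x), w(x)⟩ dx as j → ∞; and (iii) ∫_Ω |v_j(x)| dx → ∫_Ω |w(x)| dx as j → ∞. -/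
open MeasureTheory Filter Topology Set
open scoped ENNReal NNReal RealInnerProductSpace

/-- Convergence follows from convergence of arbitrarily good uniform approximations. -/
theorem tendsto_of_forall_approx {ι α : Type*} [PseudoMetricSpace α] {l : Filter ι}
    {a : ι → α} {A : α}
    (h : ∀ ε > 0, ∃ (b : ι → α) (B : α), Tendsto b l (𝓝 B) ∧
      (∀ᶠ i in l, dist (a i) (b i) ≤ ε) ∧ dist B A ≤ ε) :
    Tendsto a l (𝓝 A) := by
  rw [Metric.tendsto_nhds]
  intro ε hε
  obtain ⟨b, B, hb, hab, hBA⟩ := h (ε / 4) (by positivity)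
  filter_upwards [hab, Metric.tendsto_nhds.1 hb (ε / 4) (by positivity)] with i h1 h2
  linarith [dist_triangle4 (a i) (b i) B A]

theorem integral_fourier_of_ne_zero {T : ℝ} [hT : Fact (0 < T)] {m : ℤ} (hm : m ≠ 0) :
    ∫ t : AddCircle T, fourier m t ∂AddCircle.haarAddCircle = 0 :=
  integral_eq_zero_of_add_right_eq_neg (μ := AddCircle.haarAddCircle)
    (fourier_add_half_inv_index hm hT.out)

theorem continuous_oscillation {V α : Type*} [NormedAddCommGroup V]
    [InnerProductSpace ℝ V] [TopologicalSpace α] (G : C(UnitAddCircle, α)) (e : V) (N : ℕ) :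
    Continuous fun x : V => G ((N * ⟪x, e⟫ : ℝ) : UnitAddCircle) := by
  refine G.continuous.comp ((AddCircle.continuous_mk' _).comp ?_)
  fun_prop

section Oscillation

variable {V : Type*} [NormedAddCommGroup V] [InnerProductSpace ℝ V] [FiniteDimensional ℝ V]
  [MeasurableSpace V] [BorelSpace V]

theorem integrable_oscillation_mul {𝕜 : Type*} [RCLike 𝕜] (G : C(UnitAddCircle, 𝕜)) (e : V) (N : ℕ)
    {f : V → 𝕜} (hf : Integrable f) :
    Integrable fun x => G ((N * ⟪x, e⟫ : ℝ) : UnitAddCircle) * f x :=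
  hf.bdd_mul (c := ‖G‖) (continuous_oscillation G e N).aestronglyMeasurable
    (Eventually.of_forall fun _ => G.norm_coe_le_norm _)

theorem tendsto_integral_fourier_oscillation {e : V} (he : e ≠ 0) (f : V → ℂ) {m : ℤ}
    (hm : m ≠ 0) :
    Tendsto (fun N : ℕ => ∫ x, fourier m ((N * ⟪x, e⟫ : ℝ) : UnitAddCircle) * f x)
      atTop (𝓝 0) := by
  have hc : Tendsto (fun N : ℕ => (-(m * N : ℝ)) • e) atTop (cocompact V) := by
    rw [← Metric.cobounded_eq_cocompact, ← tendsto_norm_atTop_iff_cobounded]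
    have : ∀ N : ℕ, ‖(-(m * N : ℝ)) • e‖ = N * (|(m : ℝ)| * ‖e‖) := fun N => by
      rw [norm_smul, norm_neg, norm_mul, Real.norm_eq_abs, RCLike.norm_natCast]; ring
    simp only [this]
    exact tendsto_natCast_atTop_atTop.atTop_mul_const (by positivity)
  refine ((tendsto_integral_exp_inner_smul_cocompact f).comp hc).congr fun N => ?_
  refine integral_congr_ae (Eventually.of_forall fun x => ?_)
  simp only [Circle.smul_def, Real.fourierChar_apply, fourier_coe_apply, smul_eq_mul,
    inner_smul_right]
  congr 2
  push_cast
  ring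

/-- Fejér's mean value lemma: a rapidly oscillating continuous periodic function converges
weakly to its mean. -/
theorem tendsto_integral_complex_oscillation {e : V} (he : e ≠ 0) {f : V → ℂ} (hf : Integrable f)
    (G : C(UnitAddCircle, ℂ)) :
    Tendsto (fun N : ℕ => ∫ x, G ((N * ⟪x, e⟫ : ℝ) : UnitAddCircle) * f x)
      atTop (𝓝 ((∫ t, G t ∂AddCircle.haarAddCircle) * ∫ x, f x)) := by
  have hint : ∀ H : C(UnitAddCircle, ℂ), Integrable H AddCircle.haarAddCircle := fun H =>
    H.continuous.integrable_of_hasCompactSupport (HasCompactSupport.of_compactSpace _)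
  have hspan : ∀ H ∈ Submodule.span ℂ (range (@fourier 1)),
      Tendsto (fun N : ℕ => ∫ x, H ((N * ⟪x, e⟫ : ℝ) : UnitAddCircle) * f x)
        atTop (𝓝 ((∫ t, H t ∂AddCircle.haarAddCircle) * ∫ x, f x)) := by
    intro H hH
    induction hH using Submodule.span_induction with
    | mem H hH =>
      obtain ⟨m, rfl⟩ := hH
      rcases eq_or_ne m 0 with rfl | hm
      · simp
      · rw [integral_fourier_of_ne_zero hm, zero_mul]
        exact tendsto_integral_fourier_oscillation he f hm
    | zero => simp
    | add H K _ _ h1 h2 =>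
      simp only [ContinuousMap.add_apply, add_mul]
      rw [integral_add (hint H) (hint K), add_mul]
      refine (h1.add h2).congr fun N => ?_
      rw [integral_add (integrable_oscillation_mul H e N hf) (integrable_oscillation_mul K e N hf)]
    | smul c H _ h1 =>
      simp only [ContinuousMap.smul_apply, smul_eq_mul, mul_assoc, integral_const_mul]
      exact h1.const_mul c
  refine tendsto_of_forall_approx fun ε hε => ?_
  have hG : G ∈ closure (Submodule.span ℂ (range (@fourier 1)) : Set C(UnitAddCircle, ℂ)) := by
    rw [← Submodule.topologicalClosure_coe, span_fourier_closure_eq_top]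
    trivial
  set I := ∫ x, ‖f x‖ with hI
  have hI0 : 0 ≤ I := integral_nonneg fun _ => norm_nonneg _
  obtain ⟨H, hH, hGH⟩ := Metric.mem_closure_iff.1 hG (ε / (I + 1)) (by positivity)
  rw [dist_eq_norm] at hGH
  have hle : ‖G - H‖ * I ≤ ε := by
    calc ‖G - H‖ * I ≤ ε / (I + 1) * (I + 1) := by gcongr; linarith
      _ = ε := by field_simp
  have hpt : ∀ t, ‖G t - H t‖ ≤ ‖G - H‖ := (G - H).norm_coe_le_norm
  refine ⟨_, _, hspan H hH, Eventually.of_forall fun N => ?_, ?_⟩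
  · rw [dist_eq_norm, ← integral_sub (integrable_oscillation_mul G e N hf)
      (integrable_oscillation_mul H e N hf)]
    refine le_trans ?_ hle
    rw [hI, ← integral_const_mul]
    refine norm_integral_le_of_norm_le (hf.norm.const_mul _) (Eventually.of_forall fun x => ?_)
    rw [← sub_mul, norm_mul]
    gcongr
    exact hpt _
  · rw [dist_comm, dist_eq_norm, ← sub_mul, ← integral_sub (hint G) (hint H), norm_mul]
    refine le_trans ?_ hle
    gcongr
    · simpa using norm_integral_le_of_norm_le_const (μ := AddCircle.haarAddCircle)
        (Eventually.of_forall hpt)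
    · exact norm_integral_le_integral_norm f

theorem tendsto_integral_oscillation {e : V} (he : e ≠ 0) {f : V → ℝ} (hf : Integrable f)
    (G : C(UnitAddCircle, ℝ)) :
    Tendsto (fun N : ℕ => ∫ x, G ((N * ⟪x, e⟫ : ℝ) : UnitAddCircle) * f x)
      atTop (𝓝 ((∫ t, G t ∂AddCircle.haarAddCircle) * ∫ x, f x)) := by
  have hfc : Integrable fun x => (f x : ℂ) := hf.ofReal
  have h := tendsto_integral_complex_oscillation he hfc
    ((⟨Complex.ofReal, Complex.continuous_ofReal⟩ : C(ℝ, ℂ)).comp G)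
  simp only [ContinuousMap.comp_apply, ContinuousMap.coe_mk, ← Complex.ofReal_mul,
    integral_complex_ofReal] at h
  exact tendsto_ofReal_iff.1 (by exact_mod_cast h)

end Oscillation

/-- A continuous probability density on the circle, supported where a continuous function of
small mean is at least one. -/
theorem exists_concentrated_density {η : ℝ} (hη : 0 < η) :
    ∃ G H : C(UnitAddCircle, ℝ), (∀ t, 0 ≤ G t) ∧ ∫ t, G t ∂AddCircle.haarAddCircle = 1 ∧
      (∀ t, 0 ≤ H t) ∧ ∫ t, H t ∂AddCircle.haarAddCircle ≤ η ∧ ∀ t, G t ≠ 0 → 1 ≤ H t := by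
  have hint : ∀ H : C(UnitAddCircle, ℝ), Integrable H AddCircle.haarAddCircle := fun H =>
    H.continuous.integrable_of_hasCompactSupport (HasCompactSupport.of_compactSpace _)
  obtain ⟨U, hU, hUo, hUη⟩ := Set.exists_isOpen_lt_of_lt ({0} : Set UnitAddCircle)
    (μ := AddCircle.haarAddCircle) (ENNReal.ofReal (η / 2)) (by
      have h := AddCircle.volume_closedBall 1 (x := 0) 0
      rw [Metric.closedBall_zero, AddCircle.volume_eq_smul_haarAddCircle] at h
      rw [ENNReal.ofReal_one, one_smul] at h
      rw [h]
      simpa using hη)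
  obtain ⟨K, hK0, hK1, hK⟩ := exists_continuous_zero_one_of_isClosed hUo.isClosed_compl
    (isClosed_singleton (x := (0 : UnitAddCircle))) (disjoint_compl_left_iff_subset.2 hU)
  have hKU : ∫ t, K t ∂AddCircle.haarAddCircle ≤ η / 2 := by
    calc ∫ t, K t ∂AddCircle.haarAddCircle
        ≤ ∫ t, U.indicator 1 t ∂AddCircle.haarAddCircle := by
          refine integral_mono (hint K) ((integrable_const (1 : ℝ)).indicator hUo.measurableSet)
            fun t => ?_
          by_cases ht : t ∈ U
          · simpa [ht] using (hK t).2
          · simpa [ht] using (hK0 ht).le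
      _ = (AddCircle.haarAddCircle U).toReal := integral_indicator_one hUo.measurableSet
      _ ≤ η / 2 := ENNReal.toReal_le_of_le_ofReal (by positivity) hUη.le
  let G₀ : C(UnitAddCircle, ℝ) := ⟨fun t => max 0 (2 * K t - 1), by fun_prop⟩
  have hpos : 0 < ∫ t, G₀ t ∂AddCircle.haarAddCircle := by
    refine integral_pos_of_integrable_nonneg_nonzero G₀.continuous (hint G₀)
      (fun t => le_max_left _ _) (x := 0) ?_
    have : K 0 = 1 := hK1 rfl
    simp [G₀, this]
    norm_num
  refine ⟨(∫ t, G₀ t ∂AddCircle.haarAddCircle)⁻¹ • G₀, (2 : ℝ) • K, fun t => ?_, ?_, fun t => ?_,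
    ?_, fun t ht => ?_⟩
  · exact mul_nonneg (inv_nonneg.2 hpos.le) (le_max_left _ _)
  · simp only [ContinuousMap.smul_apply, smul_eq_mul, integral_const_mul]
    exact inv_mul_cancel₀ hpos.ne'
  · exact mul_nonneg zero_le_two (hK t).1
  · simp only [ContinuousMap.smul_apply, smul_eq_mul, integral_const_mul]
    linarith
  · by_contra! hlt
    refine ht ?_
    simp only [ContinuousMap.smul_apply, smul_eq_mul] at hlt ⊢
    have : G₀ t = 0 := max_eq_left (by linarith)
    rw [this, mul_zero]

/-- Nonnegative multipliers supported on vanishing sets whose products with each member of a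
countable family of integrable functions have asymptotically the same integral. -/
theorem exists_concentrating_multipliers {V : Type*} [NormedAddCommGroup V]
    [InnerProductSpace ℝ V] [FiniteDimensional ℝ V] [MeasurableSpace V] [BorelSpace V]
    [Nontrivial V] {Ω : Set V} (hΩ : MeasurableSet Ω) (hΩf : volume Ω ≠ ∞)
    {f : ℕ → V → ℝ} (hf : ∀ i, Integrable (f i)) :
    ∃ g : ℕ → V → ℝ, (∀ j, Continuous (g j)) ∧ (∀ j x, 0 ≤ g j x) ∧
      (∀ j, ∃ C, ∀ x, g j x ≤ C) ∧
      Tendsto (fun j => volume {x ∈ Ω | g j x ≠ 0}) atTop (𝓝 0) ∧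
      ∀ i, Tendsto (fun j => ∫ x, g j x * f i x) atTop (𝓝 (∫ x, f i x)) := by
  obtain ⟨e, he⟩ := exists_ne (0 : V)
  have key : ∀ j : ℕ, ∃ g : V → ℝ, Continuous g ∧ (∀ x, 0 ≤ g x) ∧ (∃ C, ∀ x, g x ≤ C) ∧
      volume {x ∈ Ω | g x ≠ 0} ≤ ENNReal.ofReal (1 / (j + 1 : ℝ)) ∧
      ∀ i ≤ j, dist (∫ x, g x * f i x) (∫ x, f i x) < 1 / (j + 1 : ℝ) := by
    intro j
    set δ : ℝ := 1 / (j + 1) with hδ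
    have hδ0 : 0 < δ := by positivity
    obtain ⟨G, H, hG0, hG1, hH0, hH1, hGH⟩ := exists_concentrated_density
      (η := δ / 2 / (volume.real Ω + 1)) (by positivity)
    have hΩi : Integrable (Ω.indicator (1 : V → ℝ)) :=
      (integrable_indicator_iff hΩ).2 (integrableOn_const hΩf)
    have hH := tendsto_integral_oscillation he hΩi H
    rw [integral_indicator_one hΩ] at hH
    have hlt : (∫ t, H t ∂AddCircle.haarAddCircle) * volume.real Ω < δ := by
      calc _ ≤ δ / 2 / (volume.real Ω + 1) * (volume.real Ω + 1) := by gcongr; linarith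
        _ = δ / 2 := by field_simp
        _ < δ := by linarith
    have hfin : ∀ᶠ N : ℕ in atTop, ∀ i ∈ Finset.range (j + 1),
        dist (∫ x, G ((N * ⟪x, e⟫ : ℝ) : UnitAddCircle) * f i x) (∫ x, f i x) < δ := by
      rw [Filter.eventually_all_finset]
      intro i _
      have := tendsto_integral_oscillation he (hf i) G
      rw [hG1, one_mul] at this
      exact Metric.tendsto_nhds.1 this δ hδ0
    obtain ⟨N, hN1, hN2⟩ := ((hH.eventually_lt_const hlt).and hfin).exists
    refine ⟨fun x => G ((N * ⟪x, e⟫ : ℝ) : UnitAddCircle), continuous_oscillation G e N,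
      fun x => hG0 _, ⟨‖G‖, fun x => (le_abs_self _).trans (G.norm_coe_le_norm _)⟩, ?_,
      fun i hi => hN2 i (Finset.mem_range.2 (Nat.lt_succ_of_le hi))⟩
    have hS : MeasurableSet {x ∈ Ω | G ((N * ⟪x, e⟫ : ℝ) : UnitAddCircle) ≠ 0} :=
      hΩ.inter ((continuous_oscillation G e N).measurable (measurableSet_singleton 0).compl)
    have hSf : volume {x ∈ Ω | G ((N * ⟪x, e⟫ : ℝ) : UnitAddCircle) ≠ 0} ≠ ∞ :=
      measure_ne_top_of_subset (sep_subset _ _) hΩf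
    rw [← ENNReal.ofReal_toReal hSf]
    refine ENNReal.ofReal_le_ofReal (le_trans ?_ hN1.le)
    rw [← Measure.real, ← integral_indicator_one hS]
    refine integral_mono ((integrable_indicator_iff hS).2 (integrableOn_const hSf))
      (integrable_oscillation_mul H e N hΩi) fun x => ?_
    by_cases hx : x ∈ {x ∈ Ω | G ((N * ⟪x, e⟫ : ℝ) : UnitAddCircle) ≠ 0}
    · rw [indicator_of_mem hx, indicator_of_mem hx.1, Pi.one_apply, mul_one]
      exact hGH _ hx.2
    · rw [indicator_of_notMem hx]
      exact mul_nonneg (hH0 _) (indicator_nonneg (fun _ _ => zero_le_one) x)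
  choose g hgc hg0 hgb hgv hgf using key
  have hlim : Tendsto (fun j : ℕ => 1 / (j + 1 : ℝ)) atTop (𝓝 0) :=
    tendsto_one_div_add_atTop_nhds_zero_nat
  refine ⟨g, hgc, hg0, hgb, ?_, fun i => ?_⟩
  · refine tendsto_of_tendsto_of_tendsto_of_le_of_le tendsto_const_nhds ?_
      (fun _ => zero_le) hgv
    simpa using ENNReal.tendsto_ofReal hlim
  · rw [tendsto_iff_dist_tendsto_zero]
    refine squeeze_zero' (Eventually.of_forall fun _ => dist_nonneg) ?_ hlim
    filter_upwards [eventually_ge_atTop i] with j hj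
    exact (hgf j i hj).le

/-- Approximation of an absolutely continuous measure (with density w) by a purely
concentrating sequence, converging weakly* and strictly as measures on the closure of Ω. -/
theorem concentration_approximation_of_L1
    (n d : ℕ) (hn : 0 < n) (hd : 0 < d)
    (Ω : Set (EuclideanSpace ℝ (Fin n))) (hΩo : IsOpen Ω) (hΩb : Bornology.IsBounded Ω)
    (w : EuclideanSpace ℝ (Fin n) → EuclideanSpace ℝ (Fin d))
    (hw : IntegrableOn w Ω volume) :
    ∃ v : ℕ → EuclideanSpace ℝ (Fin n) → EuclideanSpace ℝ (Fin d),
      (∀ j, IntegrableOn (v j) Ω volume) ∧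
      Tendsto (fun j => volume {x ∈ Ω | v j x ≠ 0}) atTop (𝓝 0) ∧
      (∀ φ : EuclideanSpace ℝ (Fin n) → EuclideanSpace ℝ (Fin d),
        ContinuousOn φ (closure Ω) →
        Tendsto (fun j => ∫ x in Ω, ⟪φ x, v j x⟫) atTop
          (𝓝 (∫ x in Ω, ⟪φ x, w x⟫))) ∧
      Tendsto (fun j => ∫ x in Ω, ‖v j x‖) atTop (𝓝 (∫ x in Ω, ‖w x‖)) := by
  have : Nonempty (Fin n) := ⟨⟨0, hn⟩⟩
  have hΩm := hΩo.measurableSet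
  have hK : IsCompact (closure Ω) := hΩb.isCompact_closure
  have : CompactSpace (closure Ω) := isCompact_iff_compactSpace.1 hK
  have hinner : ∀ φ : EuclideanSpace ℝ (Fin n) → EuclideanSpace ℝ (Fin d),
      ContinuousOn φ (closure Ω) → ∀ u : EuclideanSpace ℝ (Fin n) → EuclideanSpace ℝ (Fin d),
      IntegrableOn u Ω → IntegrableOn (fun x => ⟪φ x, u x⟫) Ω := by
    intro φ hφ u hu
    obtain ⟨C, hC⟩ := hK.exists_bound_of_continuousOn hφ
    refine (hu.norm.const_mul C).mono'
      (((hφ.mono subset_closure).aestronglyMeasurable hΩm).inner hu.aestronglyMeasurable) ?_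
    filter_upwards [ae_restrict_mem hΩm] with x hx
    exact (norm_inner_le_norm _ _).trans (by gcongr; exact hC x (subset_closure hx))
  obtain ⟨Φ, hΦ⟩ := TopologicalSpace.exists_dense_seq C(closure Ω, EuclideanSpace ℝ (Fin d))
  choose! ψ hψ using fun i => ContinuousMap.exists_restrict_eq isClosed_closure (Φ i)
  let f : ℕ → EuclideanSpace ℝ (Fin n) → ℝ := fun
    | 0 => Ω.indicator fun x => ‖w x‖
    | i + 1 => Ω.indicator fun x => ⟪ψ i x, w x⟫
  have hf : ∀ i, Integrable (f i) := by
    rintro (_ | i)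
    · exact (integrable_indicator_iff hΩm).2 hw.norm
    · exact (integrable_indicator_iff hΩm).2 (hinner _ (ψ i).continuous.continuousOn w hw)
  obtain ⟨g, hgc, hg0, hgb, hgv, hgf⟩ :=
    exists_concentrating_multipliers hΩm hΩb.measure_lt_top.ne hf
  have hset : ∀ (h u : EuclideanSpace ℝ (Fin n) → ℝ),
      ∫ x, h x * Ω.indicator u x = ∫ x in Ω, h x * u x := fun h u => by
    rw [← integral_indicator hΩm]
    simp only [indicator_mul_right]
  have hnorm : Tendsto (fun j => ∫ x in Ω, ‖g j x • w x‖) atTop (𝓝 (∫ x in Ω, ‖w x‖)) := by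
    have h := hgf 0
    simp only [f, hset, integral_indicator hΩm] at h
    simpa only [norm_smul, Real.norm_of_nonneg (hg0 _ _)] using h
  have htest : ∀ i, Tendsto (fun j => ∫ x in Ω, ⟪ψ i x, g j x • w x⟫) atTop
      (𝓝 (∫ x in Ω, ⟪ψ i x, w x⟫)) := fun i => by
    have h := hgf (i + 1)
    simp only [f, hset, integral_indicator hΩm] at h
    simpa only [inner_smul_right] using h
  have hv : ∀ j, IntegrableOn (fun x => g j x • w x) Ω := fun j => by
    obtain ⟨C, hC⟩ := hgb j
    refine hw.bdd_smul C (hgc j).aestronglyMeasurable (Eventually.of_forall fun x => ?_)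
    rw [Real.norm_of_nonneg (hg0 _ _)]
    exact hC x
  refine ⟨fun j x => g j x • w x, hv, ?_, fun φ hφ => ?_, hnorm⟩
  · refine tendsto_of_tendsto_of_tendsto_of_le_of_le tendsto_const_nhds hgv
      (fun _ => zero_le) fun j => measure_mono fun x hx => ⟨hx.1, fun h => hx.2 ?_⟩
    simp [h]
  · refine tendsto_of_forall_approx fun ε hε => ?_
    set S := ∫ x in Ω, ‖w x‖ with hS
    have hS0 : 0 ≤ S := integral_nonneg fun _ => norm_nonneg _
    obtain ⟨i, hi⟩ := hΦ.exists_dist_lt ⟨_, hφ.domRestrict⟩ (ε := ε / (S + 1)) (by positivity)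
    have hclose : ∀ x ∈ Ω, ‖φ x - ψ i x‖ ≤ ε / (S + 1) := fun x hx => by
      have h := (ContinuousMap.dist_apply_le_dist (⟨x, subset_closure hx⟩ : closure Ω)).trans hi.le
      rw [← hψ i, dist_eq_norm] at h
      exact h
    have hbound : ∀ u : EuclideanSpace ℝ (Fin n) → EuclideanSpace ℝ (Fin d), IntegrableOn u Ω →
        ∫ x in Ω, ‖u x‖ ≤ S + 1 →
        dist (∫ x in Ω, ⟪φ x, u x⟫) (∫ x in Ω, ⟪ψ i x, u x⟫) ≤ ε := fun u hu huS => by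
      rw [dist_eq_norm, ← integral_sub (hinner φ hφ u hu)
        (hinner _ (ψ i).continuous.continuousOn u hu)]
      calc _ ≤ ∫ x in Ω, ε / (S + 1) * ‖u x‖ := by
            refine norm_integral_le_of_norm_le (hu.norm.const_mul _) ?_
            filter_upwards [ae_restrict_mem hΩm] with x hx
            rw [← inner_sub_left]
            exact (norm_inner_le_norm _ _).trans (by gcongr; exact hclose x hx)
        _ = ε / (S + 1) * ∫ x in Ω, ‖u x‖ := integral_const_mul _ _
        _ ≤ ε / (S + 1) * (S + 1) := by gcongr
        _ = ε := by field_simp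
    refine ⟨_, _, htest i, ?_, ?_⟩
    · filter_upwards [hnorm.eventually_le_const (lt_add_one S)] with j hj
      exact hbound _ (hv j) hj
    · rw [dist_comm]
      exact hbound w hw (by linarith)
end

section
/- Let n be a positive integer, let Ω ⊂ ℝ^n be a bounded open set and set X := closure(Ω). Let μ be a finite Borel measure on X and let λ be a function assigning to each relatively open subset A of X a value λ(A) ∈ [0,∞). Assume: (ii) μ(X) ≤ λ(X); (iii) λ(A) ≤ μ(A) for every relatively open A ⊆ X; (iv) λ(A) ≤ λ(A \ closure(U)) + λ(B) whenever U, B, A are relatively open subsets of X with closure(U) ⊆ B and closure(B) ⊆ A (closures taken in X); (v) for every relatively open A ⊆ X and every ε > 0 there exists a relatively open U with closure(U) ⊆ A and λ(A \ closure(U)) < ε. Then λ(A) = μ(A) for every relatively open subset A of X. -/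
open MeasureTheory Filter Topology Set
open scoped ENNReal NNReal

/-- De Giorgi–Letta type comparison lemma: a set function `Λ` on the relatively open subsets
of `X = closure Ω` satisfying the comparison, subadditivity and inner regularity conditions
below coincides with the finite Borel measure `μ` on every relatively open subset. -/
theorem measure_representation_on_rel_open
    (n : ℕ) (hn : 0 < n)
    (Ω : Set (EuclideanSpace ℝ (Fin n))) (hΩo : IsOpen Ω) (hΩb : Bornology.IsBounded Ω)
    (μ : Measure (closure Ω : Set (EuclideanSpace ℝ (Fin n)))) (hfin : IsFiniteMeasure μ)
    (Λ : Set (closure Ω : Set (EuclideanSpace ℝ (Fin n))) → ℝ≥0)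
    (h2 : μ Set.univ ≤ (Λ Set.univ : ℝ≥0∞))
    (h3 : ∀ A, IsOpen A → (Λ A : ℝ≥0∞) ≤ μ A)
    (h4 : ∀ U B A, IsOpen U → IsOpen B → IsOpen A →
      closure U ⊆ B → closure B ⊆ A → Λ A ≤ Λ (A \ closure U) + Λ B)
    (h5 : ∀ A, IsOpen A → ∀ ε : ℝ≥0, 0 < ε →
      ∃ U, IsOpen U ∧ closure U ⊆ A ∧ Λ (A \ closure U) < ε) :
    ∀ A, IsOpen A → (Λ A : ℝ≥0∞) = μ A := by
  intro A hA
  refine le_antisymm (h3 A hA) (le_of_forall_lt fun r hr => ?_)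
  obtain ⟨F, hFA, hF, hrF⟩ := hA.exists_lt_isClosed hr
  obtain ⟨U, hU, hFU, hUA⟩ := normal_exists_closure_subset hF hA hFA
  have hsub : (Λ univ : ℝ≥0∞) ≤ Λ (univ \ closure U) + Λ A := by
    exact_mod_cast h4 U A univ hU hA isOpen_univ hUA (subset_univ _)
  have hopen : IsOpen (univ \ closure U) := isOpen_univ.sdiff isClosed_closure
  have hle : μ (univ \ closure U) + μ (closure U) ≤ μ (univ \ closure U) + Λ A :=
    calc μ (univ \ closure U) + μ (closure U)
        = μ univ := by
          rw [← compl_eq_univ_sdiff, add_comm,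
            measure_add_measure_compl isClosed_closure.measurableSet]
      _ ≤ Λ (univ \ closure U) + Λ A := h2.trans hsub
      _ ≤ μ (univ \ closure U) + Λ A := by gcongr; exact h3 _ hopen
  exact hrF.trans_le ((measure_mono (hFU.trans subset_closure)).trans
    (ENNReal.le_of_add_le_add_left (measure_ne_top μ _) hle))
end

section
/- Let M be a positive integer, K > 0, and let h : ℝ^M → ℝ be a convex function with |h(b)| ≤ K(1 + |b|) for all b ∈ ℝ^M. Let h^∞ : ℝ^M → ℝ be a function such that h^∞(b) = lim_{t→∞} h(tb)/t for every b ∈ ℝ^M. Then there exists a nonincreasing function σ : (0,∞) → [0,∞) with σ(t) → 0 as t → ∞ such that |h(tb)/t − h^∞(b)| ≤ σ(t)(|b| + 1) for all t > 0 and all b ∈ ℝ^M. -/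
open MeasureTheory Filter Topology Set

/-- A convex function of linear growth with constant `K` is `K`-Lipschitz. -/
theorem ConvexOn.sub_le_mul_norm_of_linear_growth {E : Type*} [NormedAddCommGroup E]
    [NormedSpace ℝ E] {h : E → ℝ} {K : ℝ} (hconv : ConvexOn ℝ Set.univ h) (hK : 0 ≤ K)
    (hgrowth : ∀ b, |h b| ≤ K * (1 + ‖b‖)) (x y : E) : h y - h x ≤ K * ‖y - x‖ := by
  have hlim : Tendsto (fun t : ℝ => (K * (1 + ‖x‖) - h x) / t + K * ‖y - x‖) atTop
      (𝓝 (0 + K * ‖y - x‖)) :=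
    (tendsto_const_nhds.div_atTop tendsto_id).add_const _
  rw [zero_add] at hlim
  refine ge_of_tendsto hlim ?_
  filter_upwards [eventually_ge_atTop 1] with t ht
  have ht0 : 0 < t := by linarith
  have hc := hconv.2 (mem_univ x) (mem_univ (x + t • (y - x)))
    (sub_nonneg.2 (inv_le_one_of_one_le₀ ht)) (inv_nonneg.2 ht0.le) (sub_add_cancel 1 t⁻¹)
  have hy : (1 - t⁻¹) • x + t⁻¹ • (x + t • (y - x)) = y := by
    rw [smul_add, smul_smul, inv_mul_cancel₀ ht0.ne']
    module
  rw [hy, smul_eq_mul, smul_eq_mul] at hc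
  have hz : h (x + t • (y - x)) ≤ K * (1 + (‖x‖ + t * ‖y - x‖)) := by
    refine (le_abs_self _).trans ((hgrowth _).trans ?_)
    gcongr
    refine (norm_add_le _ _).trans_eq ?_
    rw [norm_smul, Real.norm_of_nonneg ht0.le]
  calc h y - h x ≤ t⁻¹ * (h (x + t • (y - x)) - h x) := by linarith
    _ ≤ t⁻¹ * (K * (1 + (‖x‖ + t * ‖y - x‖)) - h x) := by gcongr
    _ = (K * (1 + ‖x‖) - h x) / t + K * ‖y - x‖ := by field_simp; ring

/-- A family `F s` that is bounded uniformly on each ray `s ≥ t > 0` and tends to `0` uniformly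
as `s → ∞` is dominated by a nonincreasing function of `s` tending to `0`. -/
theorem exists_antitoneOn_modulus {X : Type*} [Nonempty X] {F : ℝ → X → ℝ}
    (hF : ∀ s x, 0 ≤ F s x) (hbdd : ∀ t, 0 < t → ∃ C, ∀ s, t ≤ s → ∀ x, F s x ≤ C)
    (hlim : ∀ ε, 0 < ε → ∃ T, ∀ s, T ≤ s → ∀ x, F s x ≤ ε) :
    ∃ σ : ℝ → ℝ, AntitoneOn σ (Set.Ioi (0 : ℝ)) ∧ (∀ t : ℝ, 0 < t → 0 ≤ σ t) ∧
      Tendsto σ atTop (𝓝 0) ∧ ∀ t : ℝ, 0 < t → ∀ x, F t x ≤ σ t := by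
  let S : ℝ → Set ℝ := fun t => {r | ∃ s, t ≤ s ∧ ∃ x, F s x = r}
  have hne : ∀ t, (S t).Nonempty := fun t => ⟨_, t, le_rfl, Classical.arbitrary X, rfl⟩
  have hS : ∀ t, 0 < t → BddAbove (S t) := by
    intro t ht
    obtain ⟨C, hC⟩ := hbdd t ht
    refine ⟨C, ?_⟩
    rintro _ ⟨s, hs, x, rfl⟩
    exact hC s hs x
  have hnonneg : ∀ t, 0 ≤ sSup (S t) := by
    intro t
    refine Real.sSup_nonneg ?_
    rintro _ ⟨s, -, x, rfl⟩
    exact hF s x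
  refine ⟨fun t => sSup (S t), ?_, fun t _ => hnonneg t, ?_,
    fun t ht x => le_csSup (hS t ht) ⟨t, le_rfl, x, rfl⟩⟩
  · intro a ha b _ hab
    refine csSup_le_csSup (hS a ha) (hne b) ?_
    rintro _ ⟨s, hs, x, rfl⟩
    exact ⟨s, hab.trans hs, x, rfl⟩
  · rw [Metric.tendsto_atTop]
    intro ε hε
    obtain ⟨T, hT⟩ := hlim (ε / 2) (half_pos hε)
    refine ⟨T, fun t ht => ?_⟩
    rw [Real.dist_eq, sub_zero, abs_of_nonneg (hnonneg t)]
    refine (csSup_le (hne t) ?_).trans_lt (half_lt_self hε)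
    rintro _ ⟨s, hs, x, rfl⟩
    exact hT s (ht.trans hs) x

/-- A family of functions eventually sharing a Lipschitz constant that converges to `0` pointwise
is eventually bounded above by any `ε > 0`, uniformly on compact sets. -/
theorem IsCompact.eventually_le_of_sub_le {X ι : Type*} [PseudoMetricSpace X] {s : Set X}
    (hs : IsCompact s) {l : Filter ι} {F : ι → X → ℝ} {L : ℝ} (hL : 0 < L)
    (hLip : ∀ᶠ i in l, ∀ x y, F i y - F i x ≤ L * dist y x)
    (hlim : ∀ x, Tendsto (fun i => F i x) l (𝓝 0)) {ε : ℝ} (hε : 0 < ε) :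
    ∀ᶠ i in l, ∀ x ∈ s, F i x ≤ ε := by
  obtain ⟨N, -, hN, hcover⟩ := hs.finite_cover_balls (show 0 < ε / (2 * L) by positivity)
  have hev : ∀ᶠ i in l, ∀ x ∈ N, F i x < ε / 2 :=
    (eventually_all_finite hN).2 fun x _ => (hlim x).eventually_lt_const (half_pos hε)
  filter_upwards [hev, hLip] with i hi hLi y hy
  obtain ⟨x, hx, hyx⟩ := mem_iUnion₂.1 (hcover hy)
  have hdist : L * dist y x ≤ L * (ε / (2 * L)) :=
    mul_le_mul_of_nonneg_left (Metric.mem_ball.1 hyx).le hL.le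
  have heq : L * (ε / (2 * L)) = ε / 2 := by field_simp
  linarith [hi x hx, hLi x y]

/-- Locally uniform convergence to the recession function: for a convex `h` with linear
growth there is a nonincreasing error modulus `σ(t) → 0` with
`|h(tb)/t − h^∞(b)| ≤ σ(t)(‖b‖+1)` for all `t > 0` and `b`. -/
theorem recession_function_uniform_modulus
    (M : ℕ) (hM : 0 < M) (K : ℝ) (hK : 0 < K)
    (h : EuclideanSpace ℝ (Fin M) → ℝ) (hconv : ConvexOn ℝ Set.univ h)
    (hgrowth : ∀ b, |h b| ≤ K * (1 + ‖b‖))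
    (hinf : EuclideanSpace ℝ (Fin M) → ℝ)
    (hlim : ∀ b, Filter.Tendsto (fun t : ℝ => h (t • b) / t) Filter.atTop (𝓝 (hinf b))) :
    ∃ σ : ℝ → ℝ,
      AntitoneOn σ (Set.Ioi (0 : ℝ)) ∧
      (∀ t : ℝ, 0 < t → 0 ≤ σ t) ∧
      Filter.Tendsto σ Filter.atTop (𝓝 0) ∧
      ∀ t : ℝ, 0 < t → ∀ b, |h (t • b) / t - hinf b| ≤ σ t * (‖b‖ + 1) := by
  have hLip : ∀ s : ℝ, 0 < s → ∀ x y, h (s • y) / s - h (s • x) / s ≤ K * ‖y - x‖ := by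
    intro s hs x y
    rw [← sub_div, div_le_iff₀ hs]
    refine (hconv.sub_le_mul_norm_of_linear_growth hK.le hgrowth _ _).trans_eq ?_
    rw [← smul_sub, norm_smul, Real.norm_of_nonneg hs.le]
    ring
  have hLip_inf : ∀ x y, hinf y - hinf x ≤ K * ‖y - x‖ := fun x y =>
    le_of_tendsto ((hlim y).sub (hlim x))
      ((eventually_gt_atTop 0).mono fun s hs => hLip s hs x y)
  have hzero : hinf 0 = 0 := by
    refine tendsto_nhds_unique (hlim 0) ?_
    simp only [smul_zero]
    exact tendsto_const_nhds.div_atTop tendsto_id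
  have hhom : ∀ r : ℝ, 0 < r → ∀ b, hinf (r • b) = r * hinf b := by
    intro r hr b
    refine tendsto_nhds_unique (hlim (r • b)) ?_
    refine (((hlim b).comp (tendsto_id.atTop_mul_const hr)).const_mul r).congr fun t => ?_
    simp only [Function.comp_apply, id_eq, smul_smul]
    field_simp
  have hball : ∀ ε : ℝ, 0 < ε → ∀ᶠ s : ℝ in atTop,
      ∀ b ∈ Metric.closedBall (0 : EuclideanSpace ℝ (Fin M)) 1,
        |h (s • b) / s - hinf b| ≤ ε := by
    intro ε hε
    refine (isCompact_closedBall _ _).eventually_le_of_sub_le (L := 2 * K) (by positivity) ?_ ?_ hε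
    · filter_upwards [eventually_gt_atTop 0] with s hs x y
      refine (abs_sub_abs_le_abs_sub _ _).trans ?_
      have hxy := hLip s hs x y
      have hyx := hLip s hs y x
      have hxy_inf := hLip_inf x y
      have hyx_inf := hLip_inf y x
      rw [norm_sub_rev] at hyx hyx_inf
      rw [dist_eq_norm, abs_le]
      constructor <;> linarith
    · intro b
      simpa using ((hlim b).sub_const (hinf b)).abs
  have hpos : ∀ b : EuclideanSpace ℝ (Fin M), 0 < ‖b‖ + 1 := fun b => by positivity
  have hbdd : ∀ t : ℝ, 0 < t → ∃ C, ∀ s, t ≤ s → ∀ b,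
      |h (s • b) / s - hinf b| / (‖b‖ + 1) ≤ C := by
    intro t ht
    refine ⟨|h 0| / t + 2 * K, fun s hs b => ?_⟩
    have hs0 : 0 < s := ht.trans_le hs
    rw [div_le_iff₀ (hpos b)]
    have h1 := hLip s hs0 0 b
    have h2 := hLip s hs0 b 0
    have h3 := hLip_inf 0 b
    have h4 := hLip_inf b 0
    simp only [smul_zero, sub_zero, zero_sub, norm_neg, hzero] at h1 h2 h3 h4
    have h5 : |h 0 / s| ≤ |h 0| / t := by
      rw [abs_div, abs_of_pos hs0]
      gcongr
    have h6 : 0 ≤ |h 0| / t * ‖b‖ := by positivity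
    obtain ⟨h7, h8⟩ := abs_le.1 h5
    rw [abs_le]
    constructor <;> linarith
  have hunif : ∀ ε : ℝ, 0 < ε → ∃ T, ∀ s, T ≤ s → ∀ b,
      |h (s • b) / s - hinf b| / (‖b‖ + 1) ≤ ε := by
    intro ε hε
    obtain ⟨T, hT⟩ := eventually_atTop.1 (hball ε hε)
    refine ⟨max T 1, fun s hs b => ?_⟩
    have hsT : T ≤ s := (le_max_left _ _).trans hs
    have hs0 : 0 < s := zero_lt_one.trans_le ((le_max_right _ _).trans hs)
    rw [div_le_iff₀ (hpos b)]
    rcases le_or_gt ‖b‖ 1 with hb | hb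
    · refine (hT s hsT b (mem_closedBall_zero_iff.2 hb)).trans ?_
      exact le_mul_of_one_le_right hε.le (by linarith [norm_nonneg b])
    · have hb0 : 0 < ‖b‖ := zero_lt_one.trans hb
      have hu : ‖‖b‖⁻¹ • b‖ = 1 := by
        rw [norm_smul, norm_inv, norm_norm, inv_mul_cancel₀ hb0.ne']
      have hsb : T ≤ s * ‖b‖ := hsT.trans (le_mul_of_one_le_right hs0.le hb.le)
      have hE := hT (s * ‖b‖) hsb (‖b‖⁻¹ • b) (mem_closedBall_zero_iff.2 hu.le)
      rw [smul_smul, mul_assoc, mul_inv_cancel₀ hb0.ne', mul_one,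
        hhom _ (inv_pos.2 hb0)] at hE
      have heq : h (s • b) / s - hinf b
          = ‖b‖ * (h (s • b) / (s * ‖b‖) - ‖b‖⁻¹ * hinf b) := by
        field_simp
      rw [heq, abs_mul, abs_norm]
      nlinarith
  obtain ⟨σ, hanti, hnonneg, htendsto, hle⟩ := exists_antitoneOn_modulus
    (fun s b => div_nonneg (abs_nonneg (h (s • b) / s - hinf b)) (hpos b).le) hbdd hunif
  exact ⟨σ, hanti, hnonneg, htendsto, fun t ht b => (div_le_iff₀ (hpos b)).1 (hle t ht b)⟩
end

section
/- Let m, d be positive integers and let C₂ ≥ C₁ > 0, K > 0, κ > 0. Let f₁ : ℝ^m → ℝ be continuous with C₁ ≤ f₁(a) ≤ C₂ for all a ∈ ℝ^m; let Ψ : ℝ^d → ℝ be convex, positively 1-homogeneous, with Ψ(b) ≥ K^{-1}|b| for all b ∈ ℝ^d; let Φ : ℝ^m → ℝ be convex, positively 1-homogeneous, with Φ(ξ) ≥ κ^{-1}|ξ| for all ξ ∈ ℝ^m. For a⁺, a⁻ ∈ ℝ^m define m₀(a⁺,a⁻) as the infimum, over all pairs (g,v) ∈ L¹((−1,1);ℝ^m)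 × L¹((−1,1);ℝ^d) with ∫_{−1}^{1} g(t) dt = a⁺ − a⁻ and ∫_{−1}^{1} v(t) dt = 0, of ∫_{−1}^{1} [ f₁( a⁻ + ∫_{−1}^{x} g(t) dt ) · Ψ(v(x)) + Φ(g(x)) ] dx. Then m₀(a⁺,a⁻) = Φ(a⁺ − a⁻) for all a⁺, a⁻ ∈ ℝ^m; in particular m₀(a,a) = 0 for every a ∈ ℝ^m. -/
open MeasureTheory Filter Topology Set

/-- Jensen's inequality on `(-1, 1)` for a positively homogeneous convex function. -/
theorem ConvexOn.map_setIntegral_Ioo_le_of_homogeneous {E : Type*} [NormedAddCommGroup E]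
    [NormedSpace ℝ E] [FiniteDimensional ℝ E] {Φ : E → ℝ}
    (hΦconv : ConvexOn ℝ Set.univ Φ) (hΦhom : ∀ s : ℝ, 0 ≤ s → ∀ ξ, Φ (s • ξ) = s * Φ ξ)
    {g : ℝ → E} (hg : IntegrableOn g (Set.Ioo (-1 : ℝ) 1) volume)
    (hΦg : IntegrableOn (fun x => Φ (g x)) (Set.Ioo (-1 : ℝ) 1) volume) :
    Φ (∫ t in Set.Ioo (-1 : ℝ) 1, g t) ≤ ∫ t in Set.Ioo (-1 : ℝ) 1, Φ (g t) := by
  have hvol : volume.real (Set.Ioo (-1 : ℝ) 1) = 2 := by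
    rw [Real.volume_real_Ioo_of_le (by norm_num)]
    norm_num
  have hcont : ContinuousOn Φ Set.univ := hΦconv.continuousOn isOpen_univ
  have hjensen := hΦconv.map_set_average_le (μ := volume) (t := Set.Ioo (-1 : ℝ) 1) hcont
    isClosed_univ (by simp) (by simp) (by simp) hg hΦg
  rw [setAverage_eq, setAverage_eq, hvol, hΦhom _ (by norm_num), smul_eq_mul] at hjensen
  linarith

/-- The one-dimensional jump transition energy with zero mass constraint on `v` equals
`Φ(a⁺ − a⁻)`: competitors `u ∈ W^{1,1}((−1,1);ℝ^m)` are parametrized through their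
derivative `g` via `u(x) = a⁻ + ∫_{−1}^x g`. -/
theorem jump_energy_zero_mass
    (m d : ℕ) (hm : 0 < m) (hd : 0 < d)
    (C₁ C₂ K κ : ℝ) (hC₁ : 0 < C₁) (hC₁₂ : C₁ ≤ C₂) (hK : 0 < K) (hκ : 0 < κ)
    (f₁ : EuclideanSpace ℝ (Fin m) → ℝ) (hf₁c : Continuous f₁)
    (hf₁ : ∀ a, C₁ ≤ f₁ a ∧ f₁ a ≤ C₂)
    (Ψ : EuclideanSpace ℝ (Fin d) → ℝ) (hΨconv : ConvexOn ℝ Set.univ Ψ)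
    (hΨhom : ∀ s : ℝ, 0 ≤ s → ∀ b, Ψ (s • b) = s * Ψ b)
    (hΨlb : ∀ b, K⁻¹ * ‖b‖ ≤ Ψ b)
    (Φ : EuclideanSpace ℝ (Fin m) → ℝ) (hΦconv : ConvexOn ℝ Set.univ Φ)
    (hΦhom : ∀ s : ℝ, 0 ≤ s → ∀ ξ, Φ (s • ξ) = s * Φ ξ)
    (hΦlb : ∀ ξ, κ⁻¹ * ‖ξ‖ ≤ Φ ξ)
    (ap am : EuclideanSpace ℝ (Fin m)) :
    sInf {E : ℝ |
        ∃ (g : ℝ → EuclideanSpace ℝ (Fin m)) (v : ℝ → EuclideanSpace ℝ (Fin d)),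
          IntegrableOn g (Set.Ioo (-1 : ℝ) 1) volume ∧
          IntegrableOn v (Set.Ioo (-1 : ℝ) 1) volume ∧
          (∫ t in Set.Ioo (-1 : ℝ) 1, g t) = ap - am ∧
          (∫ t in Set.Ioo (-1 : ℝ) 1, v t) = 0 ∧
          IntegrableOn (fun x : ℝ =>
              f₁ (am + ∫ t in Set.Ioo (-1 : ℝ) x, g t) * Ψ (v x) + Φ (g x))
            (Set.Ioo (-1 : ℝ) 1) volume ∧
          E = ∫ x in Set.Ioo (-1 : ℝ) 1,
              (f₁ (am + ∫ t in Set.Ioo (-1 : ℝ) x, g t) * Ψ (v x) + Φ (g x))}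
      = Φ (ap - am) := by
  have hvol : volume.real (Set.Ioo (-1 : ℝ) 1) = 2 := by
    rw [Real.volume_real_Ioo_of_le (by norm_num)]
    norm_num
  have hΨ0 : Ψ 0 = 0 := by simpa using hΨhom 0 le_rfl 0
  have hΨnonneg : ∀ b, 0 ≤ Ψ b := fun b => le_trans (by positivity) (hΨlb b)
  have hΦnonneg : ∀ ξ, 0 ≤ Φ ξ := fun ξ => le_trans (by positivity) (hΦlb ξ)
  have hΦcont : Continuous Φ :=
    continuousOn_univ.mp (hΦconv.continuousOn isOpen_univ)
  refine IsLeast.csInf_eq ⟨?_, ?_⟩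
  · refine ⟨fun _ => (2⁻¹ : ℝ) • (ap - am), fun _ => 0, ?_, ?_, ?_, ?_, ?_, ?_⟩
    · exact integrableOn_const (by simp)
    · exact integrableOn_zero
    · rw [setIntegral_const, hvol, smul_smul]
      norm_num
    · simp
    · simp only [hΨ0, mul_zero, zero_add]
      exact integrableOn_const (by simp)
    · simp only [hΨ0, mul_zero, zero_add]
      rw [setIntegral_const, hvol, hΦhom _ (by norm_num), smul_eq_mul]
      ring
  · rintro E ⟨g, v, hg, -, hgint, -, hint, rfl⟩
    have hle : ∀ x, Φ (g x) ≤
        f₁ (am + ∫ t in Set.Ioo (-1 : ℝ) x, g t) * Ψ (v x) + Φ (g x) := fun x =>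
      le_add_of_nonneg_left
        (mul_nonneg (hC₁.le.trans (hf₁ _).1) (hΨnonneg _))
    have hΦg : IntegrableOn (fun x => Φ (g x)) (Set.Ioo (-1 : ℝ) 1) volume := by
      refine Integrable.mono' hint (hΦcont.comp_aestronglyMeasurable hg.1) ?_
      refine Eventually.of_forall fun x => ?_
      rw [Real.norm_of_nonneg (hΦnonneg _)]
      exact hle x
    rw [← hgint]
    exact (hΦconv.map_setIntegral_Ioo_le_of_homogeneous hΦhom hg hΦg).trans
      (integral_mono hΦg hint hle)
end

section
/- Let m, d be positive integers and let C₂ ≥ C₁ > 0, K > 0. Let f₁ : ℝ^m → ℝ be continuous with C₁ ≤ f₁(a) ≤ C₂ for all a ∈ ℝ^m, and set f₁^min := inf_{a ∈ ℝ^m} f₁(a). Let f : ℝ^d → ℝ be convex with K^{-1}|b| ≤ f(b) ≤ K(1 + |b|) for all b ∈ ℝ^d, and let f^∞ : ℝ^d → ℝ satisfy f^∞(b) = lim_{t→∞} f(tb)/t for every b. Then for every a ∈ ℝ^m and b ∈ ℝ^d the infimum inf { f₁(a) f(c₁) + f₁^min f^∞(c₂) : c₁, c₂ ∈ ℝ^d,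 c₁ + c₂ = b } is attained, i.e. there exist b₁, b₂ ∈ ℝ^d with b₁ + b₂ = b realizing this infimum. -/
open MeasureTheory Filter Topology Set

/-- The recession function of a convex function is convex. -/
theorem ConvexOn.of_tendsto_recession {E : Type*} [AddCommGroup E] [Module ℝ E]
    {f g : E → ℝ} (hf : ConvexOn ℝ Set.univ f)
    (hg : ∀ b, Tendsto (fun t : ℝ => f (t • b) / t) atTop (𝓝 (g b))) :
    ConvexOn ℝ Set.univ g := by
  refine ⟨convex_univ, fun x _ y _ p q hp hq hpq => ?_⟩
  refine le_of_tendsto_of_tendsto (hg _)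
    (((hg x).const_mul p).add ((hg y).const_mul q)) ?_
  filter_upwards [eventually_gt_atTop (0 : ℝ)] with t ht
  have h := hf.2 (mem_univ (t • x)) (mem_univ (t • y)) hp hq hpq
  rw [smul_comm p t x, smul_comm q t y, ← smul_add, smul_eq_mul, smul_eq_mul] at h
  calc f (t • (p • x + q • y)) / t ≤ (p * f (t • x) + q * f (t • y)) / t := by gcongr
    _ = p * (f (t • x) / t) + q * (f (t • y) / t) := by ring

/-- The infimum defining the effective density `g(a,b)` of the relaxation formula is
attained: there is a splitting `b = b₁ + b₂` minimizing
`f₁(a) f(b₁) + f₁^min f^∞(b₂)`. -/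
theorem effective_density_infimum_attained
    (m d : ℕ) (hm : 0 < m) (hd : 0 < d)
    (C₁ C₂ K : ℝ) (hC₁ : 0 < C₁) (hC₁₂ : C₁ ≤ C₂) (hK : 0 < K)
    (f₁ : EuclideanSpace ℝ (Fin m) → ℝ) (hf₁c : Continuous f₁)
    (hf₁ : ∀ a, C₁ ≤ f₁ a ∧ f₁ a ≤ C₂)
    (f : EuclideanSpace ℝ (Fin d) → ℝ) (hconv : ConvexOn ℝ Set.univ f)
    (hlower : ∀ b, K⁻¹ * ‖b‖ ≤ f b) (hupper : ∀ b, f b ≤ K * (1 + ‖b‖))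
    (finf : EuclideanSpace ℝ (Fin d) → ℝ)
    (hlim : ∀ b, Filter.Tendsto (fun t : ℝ => f (t • b) / t) Filter.atTop (𝓝 (finf b))) :
    ∀ (a : EuclideanSpace ℝ (Fin m)) (b : EuclideanSpace ℝ (Fin d)),
      ∃ b₁ b₂ : EuclideanSpace ℝ (Fin d), b₁ + b₂ = b ∧
        ∀ c₁ c₂ : EuclideanSpace ℝ (Fin d), c₁ + c₂ = b →
          f₁ a * f b₁ + (⨅ a' : EuclideanSpace ℝ (Fin m), f₁ a') * finf b₂ ≤
            f₁ a * f c₁ + (⨅ a' : EuclideanSpace ℝ (Fin m), f₁ a') * finf c₂ := by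
  intro a b
  have hmin : 0 ≤ ⨅ a', f₁ a' := Real.iInf_nonneg fun a' => hC₁.le.trans (hf₁ a').1
  have hfnonneg : ∀ x, 0 ≤ f x := fun x => le_trans (by positivity) (hlower x)
  have hfinf : ∀ x, 0 ≤ finf x := fun x => ge_of_tendsto (hlim x) <| by
    filter_upwards [eventually_gt_atTop (0 : ℝ)] with t ht
    exact div_nonneg (hfnonneg _) ht.le
  have hfc : Continuous f := continuousOn_univ.1 (hconv.continuousOn isOpen_univ)
  have hfinfc : Continuous finf :=
    continuousOn_univ.1 ((hconv.of_tendsto_recession hlim).continuousOn isOpen_univ)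
  have hcont : Continuous fun c => f₁ a * f c + (⨅ a', f₁ a') * finf (b - c) := by fun_prop
  have hcoercive : Tendsto (fun c => f₁ a * f c + (⨅ a', f₁ a') * finf (b - c))
      (cocompact _) atTop := by
    refine tendsto_atTop_mono (fun c => ?_)
      (tendsto_norm_cocompact_atTop.const_mul_atTop (by positivity : 0 < C₁ * K⁻¹))
    calc C₁ * K⁻¹ * ‖c‖ = C₁ * (K⁻¹ * ‖c‖) := mul_assoc _ _ _
      _ ≤ f₁ a * f c :=
        mul_le_mul (hf₁ a).1 (hlower c) (by positivity) (hC₁.le.trans (hf₁ a).1)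
      _ ≤ _ := le_add_of_nonneg_right (mul_nonneg hmin (hfinf _))
  obtain ⟨c, hc⟩ := hcont.exists_forall_le hcoercive
  refine ⟨c, b - c, add_sub_cancel c b, fun c₁ c₂ h => ?_⟩
  simpa only [← h, add_sub_cancel_left] using hc c₁
end
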